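/- arXiv:1705.08067 — 3 statements merged into one kernel-verified Lean document; each statement's English description precedes it below -/
import Mathlib

section
/- Let w ≥ 1, let z_1,…,z_w be complex numbers, let p ∈ ℕ, a_p ∈ ℂ with a_p ≠ 0, and let n, m be integers with 0 ≤ m ≤ n. Let ρ = (ρ_1 < … < ρ_m) and σ = (σ_1 < … < σ_m) be strictly increasing tuples with entries in {1,…,n}, let d = n − m, and let ξ, η be the complements of ρ and σ in {1,…,n}. Then det(T_n(a)_{ρ,σ}) = (−1)^{pm + |ρ| + |σ|} · a_p^m · s_{(m^p, m^d + id_d − η)/(m^d + id_d − ξ)}(z_1,…,z_w), where the partitions are α = (m,…,m [p times], m+1−η_1, m+2−η_2, …, m+d−η_d) and β = (m+1−ξ_1, …, m+d−ξ_d). -/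
open scoped BigOperators

/-- The `r`-th elementary symmetric polynomial in `w` variables, evaluated at `z`,
extended by `0` to negative integer indices (and automatically `0` for `r > w`). -/
noncomputable def eInt (w : ℕ) (z : Fin w → ℂ) (r : ℤ) : ℂ :=
  if 0 ≤ r then
    ∑ s ∈ Finset.powersetCard r.toNat (Finset.univ : Finset (Fin w)), ∏ i ∈ s, z i
  else 0

/-- The `r`-th complete homogeneous symmetric polynomial in `w` variables, evaluated at `z`,
extended by `0` to negative integer indices. -/
noncomputable def hInt (w : ℕ) (z : Fin w → ℂ) (r : ℤ) : ℂ :=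
  if 0 ≤ r then ∑ m : Sym (Fin w) r.toNat, (m.1.map z).prod else 0

/-- Skew Schur polynomial via the Jacobi–Trudi determinant
`s_{λ/μ} = det [h_{λ_j - μ_k - j + k}]_{j,k=1}^{ℓ}`,
where the parts are given as `1`-based integer sequences `lam`, `mu`. -/
noncomputable def skewSchur (w : ℕ) (z : Fin w → ℂ) (ℓ : ℕ) (lam mu : ℕ → ℤ) : ℂ :=
  Matrix.det (Matrix.of fun j k : Fin ℓ =>
    hInt w z (lam (j.1 + 1) - mu (k.1 + 1) - ((j.1 : ℤ) + 1) + ((k.1 : ℤ) + 1)))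

/-- Schur polynomial `s_λ`. -/
noncomputable def schur (w : ℕ) (z : Fin w → ℂ) (ℓ : ℕ) (lam : ℕ → ℤ) : ℂ :=
  skewSchur w z ℓ lam (fun _ => 0)

/-- Coefficients of the Laurent polynomial `a(t) = a_p t^(p-w) ∏_{j=1}^w (t - z_j)`,
namely `a_k = (-1)^(p-k) * a_p * e_{p-k}(z_1,…,z_w)`. -/
noncomputable def aCoeff (w p : ℕ) (ap : ℂ) (z : Fin w → ℂ) (k : ℤ) : ℂ :=
  (-1 : ℂ) ^ ((p : ℤ) - k) * ap * eInt w z ((p : ℤ) - k)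

/-- The `n × n` Toeplitz matrix `[a_{j-k}]_{j,k=1}^n` with coefficient sequence `a`. -/
noncomputable def toeplitz (n : ℕ) (a : ℤ → ℂ) : Matrix (Fin n) (Fin n) ℂ :=
  Matrix.of fun j k => a ((j.1 : ℤ) - (k.1 : ℤ))

section PowerSeriesFacts

open PowerSeries

variable {R : Type*} [CommRing R] {ι : Type*} [Fintype ι]

/-- The coefficients of `∏ (1 - z_i X)` are the signed elementary symmetric polynomials. -/
theorem coeff_prod_one_sub_C_mul_X (z : ι → R) (k : ℕ) :
    coeff k (∏ i, (1 - C (z i) * X)) =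
      (-1) ^ k * ∑ s ∈ Finset.powersetCard k Finset.univ, ∏ i ∈ s, z i := by
  classical
  have hterm (s : Finset ι) : ∏ i ∈ s, (-(C (z i) * X) : R⟦X⟧) =
      C ((-1) ^ s.card * ∏ i ∈ s, z i) * X ^ s.card := by
    simp [Finset.prod_neg, Finset.prod_mul_distrib, mul_assoc]
  simp only [sub_eq_add_neg, Finset.prod_one_add, hterm, map_sum, coeff_C_mul, coeff_X_pow]
  rw [Finset.mul_sum, Finset.powersetCard_eq_filter, Finset.sum_filter]
  refine Finset.sum_congr rfl fun s _ => ?_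
  by_cases h : s.card = k
  · simp [h]
  · simp [h, Ne.symm h]

/-- The coefficients of `∏ (1 - z_i X)⁻¹` are the complete homogeneous symmetric polynomials. -/
theorem coeff_prod_mk_pow [DecidableEq ι] (z : ι → R) (k : ℕ) :
    coeff k (∏ i, PowerSeries.mk fun r => z i ^ r) =
      ∑ m : Sym ι k, (m.1.map z).prod := by
  rw [coeff_prod]
  simp only [coeff_mk]
  refine (Finset.sum_bij (fun (m : Sym ι k) _ => Multiset.toFinsupp m.1) ?_ ?_ ?_ ?_).symm
  · intro m _
    rw [Finset.mem_finsuppAntidiag]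
    refine ⟨?_, Finset.subset_univ _⟩
    exact (Multiset.sum_count_eq_card fun i _ => Finset.mem_univ i).trans m.2
  · intro a _ b _ h
    exact Subtype.ext (Multiset.toFinsupp.injective h)
  · intro l hl
    rw [Finset.mem_finsuppAntidiag] at hl
    refine ⟨⟨Finsupp.toMultiset l, ?_⟩, Finset.mem_univ _, by simp⟩
    rw [Finsupp.card_toMultiset, Finsupp.sum_fintype _ _ (by simp)]
    simpa using hl.1
  · intro m _
    rw [Finset.prod_multiset_map_count]
    simp only [Multiset.toFinsupp_apply]
    refine Finset.prod_subset (Finset.subset_univ _) fun i _ hi => ?_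
    rw [Multiset.count_eq_zero_of_notMem (by simpa using hi), pow_zero]

theorem prod_mk_pow_mul_prod_one_sub_C_mul_X (z : ι → R) :
    (∏ i, PowerSeries.mk fun r => z i ^ r) * ∏ i, (1 - C (z i) * X) = 1 := by
  rw [← Finset.prod_mul_distrib]
  refine Finset.prod_eq_one fun i _ => ?_
  ext k
  rw [mul_sub, mul_one, mul_left_comm, map_sub, coeff_C_mul]
  cases k with
  | zero => simp
  | succ k => simp [coeff_succ_mul_X, pow_succ', coeff_one]

/-- The upper triangular Toeplitz matrix whose diagonals are the coefficients of `f`. -/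
noncomputable def upperToeplitz (N : ℕ) (f : R⟦X⟧) : Matrix (Fin N) (Fin N) R :=
  Matrix.of fun j k => if j ≤ k then coeff (k.1 - j.1) f else 0

theorem upperToeplitz_mul (N : ℕ) (f g : R⟦X⟧) :
    upperToeplitz N f * upperToeplitz N g = upperToeplitz N (f * g) := by
  ext i k
  simp only [upperToeplitz, Matrix.mul_apply, Matrix.of_apply, ite_mul, mul_ite, zero_mul,
    mul_zero, ← ite_and]
  split_ifs with hik
  · rw [coeff_mul, ← Finset.sum_filter]
    refine Finset.sum_bij (fun j _ => (j.1 - i.1, k.1 - j.1)) ?_ ?_ ?_ ?_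
    · intro j hj
      simp only [Finset.mem_filter, Finset.mem_univ, true_and, Fin.le_def] at hj
      simp only [Finset.HasAntidiagonal.mem_antidiagonal]
      omega
    · intro a ha b hb h
      simp only [Finset.mem_filter, Finset.mem_univ, true_and, Fin.le_def, Prod.mk.injEq]
        at ha hb h
      ext
      omega
    · rintro ⟨a, b⟩ h
      rw [Fin.le_def] at hik
      rw [Finset.HasAntidiagonal.mem_antidiagonal] at h
      dsimp only at h
      refine ⟨⟨i.1 + a, by omega⟩, ?_, ?_⟩
      · simp only [Finset.mem_filter, Finset.mem_univ, true_and, Fin.le_def]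
        omega
      · simp only [Prod.mk.injEq]
        omega
    · intro j _
      rfl
  · refine Finset.sum_eq_zero fun j _ => if_neg fun h => hik ?_
    exact h.2.trans h.1

theorem upperToeplitz_one (N : ℕ) : upperToeplitz N (1 : R⟦X⟧) = 1 := by
  ext i j
  simp only [upperToeplitz, Matrix.of_apply, coeff_one, Matrix.one_apply, Fin.ext_iff,
    Fin.le_def]
  split_ifs <;> first | rfl | omega

theorem det_upperToeplitz (N : ℕ) (f : R⟦X⟧) :
    (upperToeplitz N f).det = coeff 0 f ^ N := by
  rw [Matrix.det_of_isUpperTriangular]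
  · simp [upperToeplitz]
  · intro i j hij
    exact if_neg (not_le.mpr hij)

end PowerSeriesFacts

section Minors

open Matrix

variable {R : Type*} [CommRing R] {ι μ κ : Type*} [Fintype ι] [DecidableEq ι] [Fintype μ]
  [DecidableEq μ] [Fintype κ] [DecidableEq κ]

/-- Jacobi's complementary minor identity, with index sets given by splittings of `ι`. -/
theorem det_submatrix_inr_eq_of_mul_eq_one {A B : Matrix ι ι R} (h : A * B = 1)
    (e f : μ ⊕ κ ≃ ι) :
    (A.submatrix (e ∘ Sum.inr) (f ∘ Sum.inr)).det =
      (A.submatrix e f).det * (B.submatrix (f ∘ Sum.inl) (e ∘ Sum.inl)).det := by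
  have hAB : A.submatrix e f * B.submatrix f e = 1 := by
    rw [submatrix_mul_equiv, h, submatrix_one_equiv]
  have hA : A.submatrix e f = fromBlocks (A.submatrix e f).toBlocks₁₁
      (A.submatrix e f).toBlocks₁₂ (A.submatrix e f).toBlocks₂₁ (A.submatrix e f).toBlocks₂₂ :=
    (fromBlocks_toBlocks _).symm
  have hB : B.submatrix f e = fromBlocks (B.submatrix f e).toBlocks₁₁
      (B.submatrix f e).toBlocks₁₂ (B.submatrix f e).toBlocks₂₁ (B.submatrix f e).toBlocks₂₂ :=
    (fromBlocks_toBlocks _).symm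
  have hmul : A.submatrix e f * fromBlocks (B.submatrix f e).toBlocks₁₁ 0
      (B.submatrix f e).toBlocks₂₁ 1 = fromBlocks 1 (A.submatrix e f).toBlocks₁₂ 0
        (A.submatrix e f).toBlocks₂₂ := by
    rw [hA, hB, fromBlocks_multiply, ← fromBlocks_one, fromBlocks_inj] at hAB
    rw [hA, fromBlocks_multiply]
    simp only [toBlocks_fromBlocks₁₂, toBlocks_fromBlocks₂₂, hAB.1, hAB.2.2.1,
      Matrix.mul_zero, Matrix.mul_one, zero_add]
  have hdet := congrArg det hmul
  rw [det_mul, det_fromBlocks_zero₁₂, det_fromBlocks_zero₂₁, det_one, det_one, one_mul,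
    mul_one] at hdet
  exact hdet.symm

end Minors

section ShuffleSign

variable {m q : ℕ}

/-- The sign of a shuffle: each of the first `m` letters contributes the number of letters of the
second block that it jumps over. -/
theorem sign_finSumFinEquiv_symm_trans (e : Fin m ⊕ Fin q ≃ Fin (m + q))
    (hl : StrictMono (e ∘ Sum.inl)) (hr : StrictMono (e ∘ Sum.inr)) :
    Equiv.Perm.sign (finSumFinEquiv.symm.trans e) =
      ∏ i : Fin m, (-1 : ℤˣ) ^ ((e (Sum.inl i)).1 + i.1) := by
  have hcount (i : Fin m) : (e (Sum.inl i)).1 =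
      i.1 + (Finset.univ.filter fun j : Fin q => e (Sum.inr j) < e (Sum.inl i)).card := by
    have h1 : (Finset.univ.filter fun x => x < e (Sum.inl i)).card = (e (Sum.inl i)).1 := by
      rw [Finset.filter_gt_eq_Iio, Fin.card_Iio]
    have h2 : (Finset.univ.filter fun i' : Fin m => e (Sum.inl i') < e (Sum.inl i)).card = i.1 := by
      have (i' : Fin m) : e (Sum.inl i') < e (Sum.inl i) ↔ i' < i := hl.lt_iff_lt
      simp only [this]
      rw [Finset.filter_gt_eq_Iio, Fin.card_Iio]
    rw [← h2, ← h1]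
    simp only [Finset.card_filter]
    rw [← e.sum_comp, Fintype.sum_sum_type]
  rw [Equiv.Perm.sign_eq_prod_prod_Ioi]
  have hIoi (i : Fin (m + q)) (F : Fin (m + q) → ℤˣ) :
      ∏ j ∈ Finset.Ioi i, F j = ∏ j, if i < j then F j else 1 := by
    rw [← Finset.prod_filter]
    congr 1
    ext
    simp
  simp only [hIoi, Fin.prod_univ_add]
  have hll (i j : Fin m) : e (Sum.inl i) < e (Sum.inl j) ↔ i < j := hl.lt_iff_lt
  have hrr (i j : Fin q) : e (Sum.inr i) < e (Sum.inr j) ↔ i < j := hr.lt_iff_lt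
  have hlr (i : Fin m) (j : Fin q) : Fin.castAdd q i < Fin.natAdd m j := by
    simp only [Fin.lt_def, Fin.val_castAdd, Fin.val_natAdd]
    omega
  have hlr' (i : Fin m) (j : Fin q) : ¬ Fin.natAdd m j < Fin.castAdd q i := (hlr i j).not_gt
  have hll' (i j : Fin m) : Fin.castAdd q i < Fin.castAdd q j ↔ i < j := Iff.rfl
  have hrr' (i j : Fin q) : Fin.natAdd m i < Fin.natAdd m j ↔ i < j := by
    simp
  simp only [Equiv.trans_apply, finSumFinEquiv_symm_apply_castAdd,
    finSumFinEquiv_symm_apply_natAdd, hll, hrr, hlr, hlr', hll', hrr', if_true, if_false,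
    Finset.prod_const_one, one_mul]
  have hone (P : Prop) [Decidable P] : (if P then (if P then (1 : ℤˣ) else -1) else 1) = 1 := by
    split_ifs <;> rfl
  simp only [hone, Finset.prod_const_one, mul_one, one_mul]
  refine Finset.prod_congr rfl fun i _ => ?_
  have hsplit (j : Fin q) : (if e (Sum.inl i) < e (Sum.inr j) then (1 : ℤˣ) else -1) =
      if e (Sum.inr j) < e (Sum.inl i) then -1 else 1 := by
    have hne : e (Sum.inl i) ≠ e (Sum.inr j) := by simp
    rcases hne.lt_or_gt with h | h
    · simp [h, h.not_gt]
    · simp [h, h.not_gt]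
  simp only [hsplit]
  rw [← Finset.prod_filter, Finset.prod_const, hcount i, add_right_comm, ← two_mul, pow_add,
    pow_mul]
  simp

/-- The equivalence assembled from two injections with disjoint ranges that together exhaust
`Fin (m + q)`. -/
noncomputable def sumEquivOfDisjoint (f : Fin m → Fin (m + q)) (g : Fin q → Fin (m + q))
    (hf : Function.Injective f) (hg : Function.Injective g) (h : ∀ i j, f i ≠ g j) :
    Fin m ⊕ Fin q ≃ Fin (m + q) :=
  Equiv.ofBijective (Sum.elim f g)
    ((Fintype.bijective_iff_injective_and_card _).2 ⟨hf.sumElim hg h, by simp⟩)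

/-- Jacobi's complementary minor identity for increasing tuples of indices. -/
theorem det_submatrix_eq_det_submatrix_compl {R : Type*} [CommRing R]
    {A B : Matrix (Fin (m + q)) (Fin (m + q)) R} (hAB : A * B = 1) (hA : A.det = 1)
    {r c : Fin m → Fin (m + q)} {r' c' : Fin q → Fin (m + q)}
    (hr : StrictMono r) (hc : StrictMono c) (hr' : StrictMono r') (hc' : StrictMono c')
    (hrr' : ∀ i j, r i ≠ r' j) (hcc' : ∀ i j, c i ≠ c' j) :
    (B.submatrix c r).det =
      (∏ i, (-1) ^ ((r i).1 + (c i).1)) * (A.submatrix r' c').det := by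
  set e := sumEquivOfDisjoint r r' hr.injective hr'.injective hrr'
  set f := sumEquivOfDisjoint c c' hc.injective hc'.injective hcc'
  have hdet : (A.submatrix e f).det = ∏ i, (-1 : R) ^ ((r i).1 + (c i).1) := by
    have hperm : A.submatrix e f = (A.reindex e.symm f.symm) := rfl
    have htrans : f.symm.trans e.symm.symm =
        (finSumFinEquiv.symm.trans f).symm.trans (finSumFinEquiv.symm.trans e) := by
      ext x
      simp
    rw [hperm, Matrix.det_reindex, hA, mul_one, htrans, Equiv.Perm.sign_trans,
      Equiv.Perm.sign_symm, sign_finSumFinEquiv_symm_trans e hr hr',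
      sign_finSumFinEquiv_symm_trans f hc hc', ← Finset.prod_mul_distrib]
    push_cast
    refine Finset.prod_congr rfl fun i _ => ?_
    change (-1 : R) ^ ((r i).1 + i.1) * (-1) ^ ((c i).1 + i.1) = _
    rw [← pow_add, show (r i).1 + i.1 + ((c i).1 + i.1) = (r i).1 + (c i).1 + 2 * i.1 by ring,
      pow_add _ _ (2 * i.1), pow_mul]
    simp
  have hJ := det_submatrix_inr_eq_of_mul_eq_one hAB e f
  rw [hdet] at hJ
  change (A.submatrix r' c').det = _ * (B.submatrix c r).det at hJ
  rw [hJ, ← mul_assoc, ← Finset.prod_mul_distrib]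
  simp [← mul_pow]

end ShuffleSign

section Specialization

open PowerSeries

variable {w N : ℕ} (z : Fin w → ℂ)

theorem hInt_sub_eq_upperToeplitz (j k : Fin N) :
    hInt w z ((k.1 : ℤ) - j.1) =
      upperToeplitz N (∏ i, PowerSeries.mk fun r => z i ^ r) j k := by
  simp only [hInt, upperToeplitz, Matrix.of_apply, coeff_prod_mk_pow, Fin.le_def]
  by_cases h : j.1 ≤ k.1
  · rw [if_pos (by omega), if_pos h, show ((k.1 : ℤ) - j.1).toNat = k.1 - j.1 by omega]
  · rw [if_neg (by omega), if_neg h]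

theorem aCoeff_eq_upperToeplitz (p : ℕ) (ap : ℂ) (j k : Fin N) (t : ℤ)
    (ht : (p : ℤ) - t = (k.1 : ℤ) - j.1) :
    aCoeff w p ap z t = ap * upperToeplitz N (∏ i, (1 - C (z i) * X)) j k := by
  simp only [aCoeff, eInt, upperToeplitz, Matrix.of_apply, coeff_prod_one_sub_C_mul_X, Fin.le_def,
    ht]
  by_cases h : j.1 ≤ k.1
  · rw [if_pos (by omega), if_pos h, show ((k.1 : ℤ) - j.1).toNat = k.1 - j.1 by omega,
      ← Nat.cast_sub h, zpow_natCast]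
    ring
  · rw [if_neg (by omega), if_neg h, mul_zero, mul_zero]

end Specialization

/-- Theorem 1 (eq. 4), formula (eq:Alexandersson): every minor of a banded Toeplitz matrix is,
up to sign and a power of `a_p`, the skew Schur polynomial
`s_{(m^p, m^d + id_d - η)/(m^d + id_d - ξ)}` evaluated at the zeros of `a`. -/
theorem toeplitz_minor_eq_skewSchur_alexandersson
    (w : ℕ) (hw : 1 ≤ w) (z : Fin w → ℂ) (p : ℕ) (ap : ℂ) (hap : ap ≠ 0)
    (n m d : ℕ) (hmn : m ≤ n) (hd : d = n - m)
    (ρ σ ξ η : ℕ → ℕ)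
    (hρmono : StrictMonoOn ρ (Set.Icc 1 m)) (hσmono : StrictMonoOn σ (Set.Icc 1 m))
    (hξmono : StrictMonoOn ξ (Set.Icc 1 d)) (hηmono : StrictMonoOn η (Set.Icc 1 d))
    (hρran : ρ '' Set.Icc 1 m ⊆ Set.Icc 1 n)
    (hσran : σ '' Set.Icc 1 m ⊆ Set.Icc 1 n)
    (hξran : ξ '' Set.Icc 1 d = Set.Icc 1 n \ ρ '' Set.Icc 1 m)
    (hηran : η '' Set.Icc 1 d = Set.Icc 1 n \ σ '' Set.Icc 1 m) :
    Matrix.det (Matrix.of fun j k : Fin m =>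
        aCoeff w p ap z ((ρ (j.1 + 1) : ℤ) - (σ (k.1 + 1) : ℤ)))
      = (-1 : ℂ) ^ (p * m + (∑ j ∈ Finset.Icc 1 m, ρ j) + ∑ j ∈ Finset.Icc 1 m, σ j)
        * ap ^ m
        * skewSchur w z (p + d)
            (fun j => if j ≤ p then (m : ℤ)
              else (m : ℤ) + ((j - p : ℕ) : ℤ) - (η (j - p) : ℤ))
            (fun k => if k ≤ d then (m : ℤ) + (k : ℤ) - (ξ k : ℤ) else 0) := by
  have hn : n = m + d := by omega
  have bound {l : ℕ} {τ : ℕ → ℕ} (h : τ '' Set.Icc 1 l ⊆ Set.Icc 1 n) (i : ℕ) (hi : i < l) :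
      1 ≤ τ (i + 1) ∧ τ (i + 1) ≤ n := h ⟨i + 1, ⟨by omega, by omega⟩, rfl⟩
  have mono {l : ℕ} {τ : ℕ → ℕ} (h : StrictMonoOn τ (Set.Icc 1 l)) (i j : ℕ) (hj : j < l)
      (hij : i < j) : τ (i + 1) < τ (j + 1) :=
    h ⟨by omega, by omega⟩ ⟨by omega, by omega⟩ (by omega)
  have disj {τ τ' : ℕ → ℕ} (h : τ' '' Set.Icc 1 d = Set.Icc 1 n \ τ '' Set.Icc 1 m) (i j : ℕ)
      (hi : i < m) (hj : j < d) : τ (i + 1) ≠ τ' (j + 1) := fun hij =>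
    (h.subset ⟨j + 1, ⟨by omega, by omega⟩, rfl⟩).2 ⟨i + 1, ⟨by omega, by omega⟩, hij⟩
  have bρ := bound hρran
  have bσ := bound hσran
  have bξ := bound (hξran.subset.trans Set.sdiff_subset)
  have bη := bound (hηran.subset.trans Set.sdiff_subset)
  let r : Fin m → Fin (m + (p + d)) := fun i =>
    ⟨p + (σ (i.1 + 1) - 1), by have := bσ i.1 i.2; omega⟩
  let c : Fin m → Fin (m + (p + d)) := fun i =>
    ⟨ρ (i.1 + 1) - 1, by have := bρ i.1 i.2; omega⟩
  let r' : Fin (p + d) → Fin (m + (p + d)) := fun j =>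
    ⟨if j.1 < p then j.1 else p + (η (j.1 - p + 1) - 1), by
      split_ifs
      · omega
      · have := bη (j.1 - p) (by omega)
        omega⟩
  let c' : Fin (p + d) → Fin (m + (p + d)) := fun k =>
    ⟨if k.1 < d then ξ (k.1 + 1) - 1 else m + k.1, by
      split_ifs with h
      · have := bξ k.1 h
        omega
      · omega⟩
  have hr : StrictMono r := fun i j hij => by
    have := mono hσmono i j j.2 hij
    have := bσ i i.2
    simp only [r, Fin.lt_def]
    omega
  have hc : StrictMono c := fun i j hij => by
    have := mono hρmono i j j.2 hij
    have := bρ i i.2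
    simp only [c, Fin.lt_def]
    omega
  have hr' : StrictMono r' := fun i j hij => by
    rw [Fin.lt_def] at hij
    simp only [r', Fin.lt_def]
    split_ifs with h1 h2 h2
    · exact hij
    · omega
    · omega
    · have := mono hηmono (i.1 - p) (j.1 - p) (by omega) (by omega)
      have := bη (i.1 - p) (by omega)
      omega
  have hc' : StrictMono c' := fun i j hij => by
    rw [Fin.lt_def] at hij
    simp only [c', Fin.lt_def]
    split_ifs with h1 h2 h2
    · have := mono hξmono i.1 j.1 h2 hij
      have := bξ i.1 h1
      omega
    · have := bξ i.1 h1
      omega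
    · omega
    · omega
  have hrr' (i j) : r i ≠ r' j := by
    have := bσ i i.2
    simp only [r, r', ne_eq, Fin.mk.injEq]
    split_ifs with h
    · omega
    · have := disj hηran i (j.1 - p) i.2 (by omega)
      have := bη (j.1 - p) (by omega)
      omega
  have hcc' (i j) : c i ≠ c' j := by
    have := bρ i i.2
    simp only [c, c', ne_eq, Fin.mk.injEq]
    split_ifs with h
    · have := disj hξran i j.1 i.2 h
      have := bξ j.1 h
      omega
    · omega
  set H : PowerSeries ℂ := ∏ i, PowerSeries.mk fun r => z i ^ r with hH
  set E : PowerSeries ℂ := ∏ i, (1 - PowerSeries.C (z i) * PowerSeries.X)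
  have hHE : upperToeplitz (m + (p + d)) H * upperToeplitz (m + (p + d)) E = 1 := by
    rw [upperToeplitz_mul, prod_mk_pow_mul_prod_one_sub_C_mul_X, upperToeplitz_one]
  have hdetH : (upperToeplitz (m + (p + d)) H).det = 1 := by
    rw [det_upperToeplitz, hH, coeff_prod_mk_pow]
    simp [Sym.eq_nil_of_card_zero]
  have hminor : (Matrix.of fun j k : Fin m =>
      aCoeff w p ap z ((ρ (j.1 + 1) : ℤ) - (σ (k.1 + 1) : ℤ))) =
      ap • (upperToeplitz (m + (p + d)) E).submatrix c r := by
    ext j k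
    refine aCoeff_eq_upperToeplitz z p ap (c j) (r k) _ ?_
    have := bρ j j.2
    have := bσ k k.2
    simp only [c, r]
    omega
  have hskew : skewSchur w z (p + d)
      (fun j => if j ≤ p then (m : ℤ) else (m : ℤ) + ((j - p : ℕ) : ℤ) - (η (j - p) : ℤ))
      (fun k => if k ≤ d then (m : ℤ) + (k : ℤ) - (ξ k : ℤ) else 0) =
      ((upperToeplitz (m + (p + d)) H).submatrix r' c').det := by
    refine congrArg Matrix.det ?_
    ext j k
    rw [Matrix.submatrix_apply, ← hInt_sub_eq_upperToeplitz, Matrix.of_apply]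
    congr 1
    have hj : (if j.1 + 1 ≤ p then (m : ℤ)
        else (m : ℤ) + ((j.1 + 1 - p : ℕ) : ℤ) - (η (j.1 + 1 - p) : ℤ)) =
        m + j.1 - (r' j).1 := by
      simp only [r', Nat.succ_le_iff]
      split_ifs with h
      · omega
      · have := bη (j.1 - p) (by omega)
        rw [show j.1 + 1 - p = j.1 - p + 1 by omega]
        omega
    have hk : (if k.1 + 1 ≤ d then (m : ℤ) + ((k.1 + 1 : ℕ) : ℤ) - (ξ (k.1 + 1) : ℤ) else 0) =
        m + k.1 - (c' k).1 := by
      simp only [c', Nat.succ_le_iff]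
      split_ifs with h
      · have := bξ k.1 h
        omega
      · omega
    beta_reduce
    rw [hj, hk]
    ring
  have hsum (τ : ℕ → ℕ) : ∑ j ∈ Finset.Icc 1 m, τ j = ∑ i : Fin m, τ (i.1 + 1) := by
    rw [Fin.sum_univ_eq_sum_range fun i => τ (i + 1), Finset.range_eq_Ico,
      Finset.sum_Ico_add' τ 0 m 1, zero_add]
    rfl
  have hsign : ∏ i, (-1 : ℂ) ^ ((r i).1 + (c i).1) =
      (-1 : ℂ) ^ (p * m + (∑ j ∈ Finset.Icc 1 m, ρ j) + ∑ j ∈ Finset.Icc 1 m, σ j) := by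
    have hpm : p * m = ∑ _i : Fin m, p := by simp [mul_comm]
    rw [hsum, hsum, hpm, ← Finset.sum_add_distrib, ← Finset.sum_add_distrib,
      ← Finset.prod_pow_eq_pow_sum]
    refine Finset.prod_congr rfl fun i _ => ?_
    have := bρ i i.2
    have := bσ i i.2
    rw [show p + ρ (i.1 + 1) + σ (i.1 + 1) = (r i).1 + (c i).1 + 2 by simp only [r, c]; omega]
    simp [pow_add]
  rw [hminor, Matrix.det_smul, Fintype.card_fin, hskew,
    det_submatrix_eq_det_submatrix_compl hHE hdetH hr hc hr' hc' hrr' hcc', hsign]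
  ring
end

section
/- Let w ≥ 1, let z_1,…,z_w be complex numbers, let p ∈ ℕ, a_p ∈ ℂ with a_p ≠ 0, and let n ≥ 1. Then det(T_n(a)) = (−1)^{pn} · a_p^n · s_{(n^p)}(z_1,…,z_w), where (n^p) is the rectangular partition with p parts all equal to n. -/
open scoped BigOperators

open Finset PowerSeries in
/-- The generating function identity `∑ h_r X^r = ∏ 1 / (1 - z_i X)`. -/
theorem coeff_prod_geometric (w : ℕ) (z : Fin w → ℂ) (r : ℕ) :
    coeff r (∏ i, (mk fun k => z i ^ k : PowerSeries ℂ)) = hInt w z r := by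
  rw [coeff_prod, hInt, if_pos (Int.natCast_nonneg r), Int.toNat_natCast]
  refine Finset.sum_bij' (fun l hl => (Sym.equivNatSum (Fin w) r).symm
    ⟨l, by rw [mem_finsuppAntidiag] at hl; rw [Finsupp.sum_fintype _ _ (by simp)]; exact hl.1⟩)
    (fun m _ => (Sym.equivNatSum (Fin w) r m : Fin w →₀ ℕ)) ?_ ?_ ?_ ?_ ?_
  · simp
  · intro m _
    have h := (Sym.equivNatSum (Fin w) r m).2
    rw [Finsupp.sum_fintype _ _ (by simp)] at h
    exact mem_finsuppAntidiag.mpr ⟨h, subset_univ _⟩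
  · intro l hl
    simp
  · intro m _
    simp
  · intro l hl
    change _ = ((Finsupp.toMultiset l).map z).prod
    rw [Finsupp.toMultiset_map, Finsupp.prod_toMultiset, Finsupp.prod_mapDomain_index
      (by simp) (by simp [pow_add]), Finsupp.prod_fintype _ _ (by simp)]
    simp

open Finset PowerSeries in
/-- The generating function identity `∑ (-1)^r e_r X^r = ∏ (1 - z_i X)`. -/
theorem coeff_prod_one_sub (w : ℕ) (z : Fin w → ℂ) (r : ℕ) :
    coeff r (∏ i, (1 - C (z i) * X : PowerSeries ℂ)) = (-1) ^ r * eInt w z r := by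
  rw [eInt, if_pos (Int.natCast_nonneg r), Int.toNat_natCast]
  simp_rw [sub_eq_add_neg]
  rw [prod_one_add, map_sum, powersetCard_eq_filter, sum_filter, mul_sum]
  refine sum_congr rfl fun s _ => ?_
  have h : ∏ i ∈ s, (-(C (z i) * X) : PowerSeries ℂ)
      = C ((-1) ^ #s * ∏ i ∈ s, z i) * X ^ #s := by
    rw [prod_neg, prod_mul_distrib, prod_const, map_mul, map_pow, map_neg, map_one, map_prod,
      mul_assoc]
  rw [h, coeff_C_mul, coeff_X_pow]
  by_cases hs : #s = r
  · simp [hs]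
  · simp [hs, Ne.symm hs]

open PowerSeries in
theorem prod_geometric_mul_prod_one_sub (w : ℕ) (z : Fin w → ℂ) :
    (∏ i, (mk fun k => z i ^ k : PowerSeries ℂ)) * ∏ i, (1 - C (z i) * X) = 1 := by
  rw [← Finset.prod_mul_distrib]
  refine Finset.prod_eq_one fun i _ => ?_
  ext k
  rcases k with _ | k
  · simp
  · rw [mul_sub, mul_one, map_sub, mul_left_comm, coeff_C_mul, coeff_succ_mul_X]
    simp [coeff_one, pow_succ']

/-- The lower triangular Toeplitz matrix of a power series. -/
noncomputable def PowerSeries.lowerToeplitz {R : Type*} [CommRing R] (N : ℕ) (F : PowerSeries R) :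
    Matrix (Fin N) (Fin N) R :=
  Matrix.of fun i j => if j ≤ i then coeff (i.1 - j.1) F else 0

namespace PowerSeries

variable {R : Type*} [CommRing R] (N : ℕ)

theorem lowerToeplitz_apply_eq_coeff (F : PowerSeries R) (i j : Fin N) :
    PowerSeries.lowerToeplitz N F i j = coeff i.1 (X ^ j.1 * F) := by
  rw [coeff_X_pow_mul']
  rfl

theorem lowerToeplitz_apply_of_val_eq (F : PowerSeries R) {i j : Fin N} {a b : ℕ}
    (hi : (i : ℕ) = a) (hj : (j : ℕ) = b) :
    PowerSeries.lowerToeplitz N F i j = if b ≤ a then coeff (a - b) F else 0 := by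
  subst hi hj
  rfl

theorem lowerToeplitz_mul (F G : PowerSeries R) :
    lowerToeplitz N F * lowerToeplitz N G = lowerToeplitz N (F * G) := by
  ext i k
  rw [Matrix.mul_apply, lowerToeplitz_apply_eq_coeff, mul_comm F G, ← mul_assoc, coeff_mul,
    Finset.Nat.sum_antidiagonal_eq_sum_range_succ
      (fun a b => coeff a (X ^ k.1 * G) * coeff b F) i.1]
  have h : ∀ j : Fin N, lowerToeplitz N F i j * lowerToeplitz N G j k
      = (fun a : ℕ => if a ≤ i.1 then coeff a (X ^ k.1 * G) * coeff (i.1 - a) F else 0) j.1 := by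
    intro j
    rw [lowerToeplitz_apply_eq_coeff N G, lowerToeplitz, Matrix.of_apply, ite_mul, zero_mul,
      mul_comm]
    rfl
  rw [Finset.sum_congr rfl fun j _ => h j, Fin.sum_univ_eq_sum_range (fun a : ℕ =>
    if a ≤ i.1 then coeff a (X ^ k.1 * G) * coeff (i.1 - a) F else 0), ← Finset.sum_filter]
  refine Finset.sum_congr ?_ fun _ _ => rfl
  ext a
  simp only [Finset.mem_filter, Finset.mem_range]
  lia

theorem lowerToeplitz_one : lowerToeplitz N (1 : PowerSeries R) = 1 := by
  ext i j
  rw [lowerToeplitz_apply_eq_coeff, mul_one, coeff_X_pow, Matrix.one_apply]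
  simp [Fin.ext_iff]

theorem det_lowerToeplitz (F : PowerSeries R) :
    (lowerToeplitz N F).det = constantCoeff F ^ N := by
  rw [Matrix.det_of_isLowerTriangular]
  · simp [lowerToeplitz]
  · intro i j hij
    exact if_neg (not_le.mpr hij)

end PowerSeries

/-- Jacobi's complementary minor identity for a block decomposition. -/
theorem Matrix.det_mul_det_toBlocks₂₂_of_mul_eq_one {R m n : Type*} [CommRing R]
    [Fintype m] [DecidableEq m] [Fintype n] [DecidableEq n] {A B : Matrix (m ⊕ n) (m ⊕ n) R}
    (h : A * B = 1) : A.det * B.toBlocks₂₂.det = A.toBlocks₁₁.det := by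
  have key : A * fromBlocks 1 B.toBlocks₁₂ 0 B.toBlocks₂₂
      = fromBlocks A.toBlocks₁₁ 0 A.toBlocks₂₁ 1 := by
    rw [← fromBlocks_toBlocks A, ← fromBlocks_toBlocks B, fromBlocks_multiply,
      ← fromBlocks_one, fromBlocks_inj] at h
    conv_lhs => rw [← fromBlocks_toBlocks A]
    rw [fromBlocks_multiply]
    simp [h.2.1, h.2.2.2]
  simpa using congrArg det key

theorem coe_finRotate_pow {N : ℕ} (m : ℕ) (i : Fin N) :
    ((finRotate N ^ m) i : ℕ) = (i + m) % N := by
  induction m with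
  | zero => simp [Nat.mod_eq_of_lt i.2]
  | succ m ih =>
    have := i.neZero
    rw [pow_succ', Equiv.Perm.mul_apply, finRotate_apply, Fin.val_add, ih, Fin.val_one']
    simp [add_assoc]

/-- Formula (eq:Tdet): `det T_n(a) = (-1)^{pn} a_p^n s_{(n^p)}(z_1,…,z_w)`. -/
theorem toeplitz_det_eq_schur
    (w : ℕ) (hw : 1 ≤ w) (z : Fin w → ℂ) (p : ℕ) (ap : ℂ) (hap : ap ≠ 0)
    (n : ℕ) (hn : 1 ≤ n) :
    Matrix.det (toeplitz n (aCoeff w p ap z))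
      = (-1 : ℂ) ^ (p * n) * ap ^ n * schur w z p (fun _ => (n : ℤ)) := by
  set F : PowerSeries ℂ := ∏ i, PowerSeries.mk fun k => z i ^ k with hF
  set G : PowerSeries ℂ := ∏ i, (1 - PowerSeries.C (z i) * PowerSeries.X) with hG
  let ρ : Equiv.Perm (Fin (p + n)) := finRotate (p + n) ^ n
  let τ : Fin p ⊕ Fin n ≃ Fin (p + n) := finSumFinEquiv
  let A := (PowerSeries.lowerToeplitz (p + n) F).submatrix (τ.trans ρ) τ
  let B := (PowerSeries.lowerToeplitz (p + n) G).submatrix τ (τ.trans ρ)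
  have hρl (k : Fin p) : (ρ (τ (Sum.inl k)) : ℕ) = k + n := by
    simp only [ρ, τ, coe_finRotate_pow, finSumFinEquiv_apply_left, Fin.val_castAdd]
    exact Nat.mod_eq_of_lt (by lia)
  have hρr (k : Fin n) : (ρ (τ (Sum.inr k)) : ℕ) = k := by
    simp only [ρ, τ, coe_finRotate_pow, finSumFinEquiv_apply_right, Fin.val_natAdd]
    rw [show p + k.1 + n = k.1 + (p + n) by ring, Nat.add_mod_right]
    exact Nat.mod_eq_of_lt (by lia)
  have hAB : A * B = 1 := by
    rw [Matrix.submatrix_mul_equiv, PowerSeries.lowerToeplitz_mul,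
      prod_geometric_mul_prod_one_sub, PowerSeries.lowerToeplitz_one,
      Matrix.submatrix_one_equiv]
  have hdetA : A.det = (-1) ^ (p * n) := by
    have h : A = ((PowerSeries.lowerToeplitz (p + n) F).submatrix ρ id).submatrix τ τ := rfl
    rw [h, Matrix.det_submatrix_equiv_self, Matrix.det_permute, PowerSeries.det_lowerToeplitz]
    have hF0 : PowerSeries.constantCoeff F = 1 := by simp [hF]
    rw [hF0, one_pow, mul_one, map_pow, sign_finRotate, ← pow_mul]
    push_cast
    obtain ⟨m, rfl⟩ : ∃ m, n = m + 1 := ⟨n - 1, by lia⟩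
    rw [show (p + (m + 1) - 1) * (m + 1) = p * (m + 1) + m * (m + 1) by
      rw [← add_assoc, Nat.add_sub_cancel]; ring, pow_add, (Nat.even_mul_succ_self m).neg_one_pow,
      mul_one]
  have hA : A.toBlocks₁₁.det = schur w z p fun _ => (n : ℤ) := by
    rw [schur, skewSchur, ← Matrix.det_transpose]
    congr 1
    ext j k
    have hA_apply : A (Sum.inl k) (Sum.inl j) = if j.1 ≤ k + n then
        PowerSeries.coeff (k + n - j.1) F else 0 :=
      PowerSeries.lowerToeplitz_apply_of_val_eq _ F (hρl k) (by simp [τ])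
    change A (Sum.inl k) (Sum.inl j) = hInt w z _
    rw [hA_apply]
    by_cases h : j.1 ≤ k + n
    · rw [if_pos h, hF, coeff_prod_geometric]
      congr 1
      lia
    · rw [if_neg h, hInt, if_neg (by lia)]
  have hB : toeplitz n (aCoeff w p ap z) = ap • B.toBlocks₂₂.transpose := by
    ext j k
    have hB_apply : B (Sum.inr k) (Sum.inr j) = if j.1 ≤ p + k then
        PowerSeries.coeff (p + k.1 - j.1) G else 0 :=
      PowerSeries.lowerToeplitz_apply_of_val_eq _ G (by simp [τ]) (hρr j)
    change aCoeff w p ap z _ = ap * B (Sum.inr k) (Sum.inr j)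
    rw [hB_apply, aCoeff]
    by_cases h : j.1 ≤ p + k
    · rw [if_pos h, hG, coeff_prod_one_sub, ← zpow_natCast,
        show ((p + k.1 - j.1 : ℕ) : ℤ) = p - (j.1 - k.1) by lia]
      ring
    · rw [if_neg h, eInt, if_neg (by lia), mul_zero, mul_zero]
  have key := Matrix.det_mul_det_toBlocks₂₂_of_mul_eq_one hAB
  rw [hB, Matrix.det_smul, Matrix.det_transpose, Fintype.card_fin, ← hA, ← key, hdetA]
  have hs : ((-1 : ℂ) ^ (p * n)) * (-1) ^ (p * n) = 1 := by
    rw [← mul_pow]; simp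
  linear_combination (-(ap ^ n * B.toBlocks₂₂.det)) * hs
end

section
/- Let w ≥ 1, let z_1,…,z_w be complex numbers, let p ≥ 1, a_p ∈ ℂ with a_p ≠ 0, and let n ≥ 1. Then for every r, s ∈ {1,…,n}, adj(T_n(a))_{r,s} = (−1)^{p(n−1)} · a_p^{n−1} · Σ_{k = max(0, s−r)}^{min(n−r, s−1)} s_{((n−1)^{p−1}, n+s−r−1−k, k)}(z_1,…,z_w), where each summand is the Schur polynomial of the partition ((n−1) repeated p−1 times, then n+s−r−1−k, then k); if the lower summation limit exceeds the upper one the sum is empty. -/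
open scoped BigOperators

section Generating

open PowerSeries

variable {w : ℕ} (z : Fin w → ℂ)

theorem hInt_of_neg {r : ℤ} (hr : r < 0) : hInt w z r = 0 := if_neg (not_le.mpr hr)

theorem eInt_of_neg {r : ℤ} (hr : r < 0) : eInt w z r = 0 := if_neg (not_le.mpr hr)

theorem mk_hInt_eq_prod :
    (PowerSeries.mk fun k : ℕ => hInt w z k) = ∏ i, PowerSeries.mk fun k => z i ^ k := by
  ext d
  rw [coeff_prod, coeff_mk, hInt, if_pos (Int.natCast_nonneg d)]
  simp only [Int.toNat_natCast, coeff_mk]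
  refine Finset.sum_bij' (fun m _ => Multiset.toFinsupp m.1)
    (fun l hl => ⟨Finsupp.toMultiset l, ?_⟩) ?_ ?_ ?_ ?_ ?_
  · rw [Finset.mem_finsuppAntidiag] at hl
    rw [Finsupp.card_toMultiset, Finsupp.sum_fintype _ _ (by simp)]
    exact hl.1
  · intro m _
    rw [Finset.mem_finsuppAntidiag]
    refine ⟨?_, Finset.subset_univ _⟩
    have h := Multiset.sum_count_eq_card (s := Finset.univ) (m := m.1) fun i _ => Finset.mem_univ i
    exact h.trans m.2
  · exact fun _ _ => Finset.mem_univ _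
  · intro m _
    exact Subtype.ext (by simp)
  · intros; simp
  · intro m _
    rw [Finset.prod_multiset_map_count]
    refine (Finset.prod_subset (Finset.subset_univ _) fun i _ hi => ?_).trans (by simp)
    rw [Multiset.mem_toFinset] at hi
    rw [Multiset.count_eq_zero_of_notMem hi, pow_zero]

theorem mk_eInt_eq_prod :
    (PowerSeries.mk fun k : ℕ => (-1) ^ k * eInt w z k) = ∏ i, (1 - C (z i) * X) := by
  ext d
  simp only [sub_eq_add_neg, Finset.prod_one_add, map_sum, coeff_mk, eInt,
    if_pos (Int.natCast_nonneg d), Int.toNat_natCast]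
  have key (t : Finset (Fin w)) : coeff d (∏ i ∈ t, -(C (z i) * X)) =
      if t.card = d then (-1) ^ d * ∏ i ∈ t, z i else 0 := by
    rw [Finset.prod_neg, Finset.prod_mul_distrib, Finset.prod_const, ← map_prod]
    have : ((-1 : PowerSeries ℂ) ^ t.card) = C ((-1) ^ t.card) := by simp
    rw [this, coeff_C_mul, coeff_C_mul, coeff_X_pow]
    split_ifs with h1 h2 h2
    · simp [h1]
    · exact absurd h1.symm h2
    · exact absurd h2.symm h1
    · simp
  simp only [key, ← Finset.sum_filter, Finset.powersetCard_eq_filter, Finset.mul_sum]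

theorem mk_eInt_mul_mk_hInt :
    (PowerSeries.mk fun k : ℕ => (-1) ^ k * eInt w z k) * (PowerSeries.mk fun k : ℕ => hInt w z k)
      = 1 := by
  rw [mk_eInt_eq_prod, mk_hInt_eq_prod, ← Finset.prod_mul_distrib]
  refine Finset.prod_eq_one fun i _ => ?_
  ext d
  rw [sub_mul, one_mul, mul_assoc, map_sub, coeff_C_mul]
  cases d with
  | zero => simp
  | succ d => simp [coeff_succ_X_mul, pow_succ', coeff_one]

theorem hInt_zero : hInt w z 0 = 1 := by
  rw [hInt, if_pos le_rfl, Int.toNat_zero, Fintype.sum_unique]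
  rfl

/-- The upper triangular Toeplitz matrices built from `(-1)^k e_k` and from `h_k` are inverse. -/
theorem toeplitz_eInt_mul_toeplitz_hInt (N : ℕ) :
    (Matrix.of fun x y : Fin N => (-1 : ℂ) ^ ((y : ℤ) - x) * eInt w z ((y : ℤ) - x)) *
      (Matrix.of fun x y : Fin N => hInt w z ((y : ℤ) - x)) = 1 := by
  ext x y
  rw [Matrix.mul_apply, Matrix.one_apply]
  simp only [Matrix.of_apply]
  rw [Fin.sum_univ_eq_sum_range (fun v => (-1 : ℂ) ^ ((v : ℤ) - (x : ℕ)) *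
    eInt w z ((v : ℤ) - (x : ℕ)) * hInt w z (((y : ℕ) : ℤ) - v)) N]
  rcases lt_or_ge y x with hxy | hxy
  · rw [if_neg (ne_of_gt hxy)]
    refine Finset.sum_eq_zero fun v _ => ?_
    rcases lt_or_ge v (x : ℕ) with h | h
    · rw [eInt_of_neg z (by omega)]; ring
    · rw [hInt_of_neg z (by have : (y : ℕ) < x := hxy; omega)]; ring
  · have hle : (x : ℕ) ≤ y := hxy
    have h := congrArg (coeff ((y : ℕ) - x)) (mk_eInt_mul_mk_hInt z)
    rw [coeff_mul, Finset.Nat.sum_antidiagonal_eq_sum_range_succ_mk, coeff_one] at h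
    simp only [coeff_mk] at h
    have hxy' : (x = y) ↔ ((y : ℕ) - x = 0) := by rw [Fin.ext_iff]; omega
    simp only [hxy']
    rw [← h]
    symm
    refine Finset.sum_of_injOn (fun i => (x : ℕ) + i) (fun _ _ _ _ h => by simpa using h) ?_ ?_ ?_
    · intro i hi
      simp only [Finset.coe_range, Set.mem_Iio] at hi ⊢
      have := y.2
      omega
    · intro v _ hv
      simp only [Finset.coe_range, Set.mem_image, Set.mem_Iio, not_exists, not_and] at hv
      rcases lt_or_ge v (x : ℕ) with h | h
      · rw [eInt_of_neg z (by omega)]; ring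
      · have := hv (v - x)
        rw [hInt_of_neg z (by omega)]; ring
    · intro i hi
      rw [Finset.mem_range] at hi
      rw [show (((x : ℕ) + i : ℕ) : ℤ) - (x : ℕ) = (i : ℕ) by push_cast; ring, zpow_natCast,
        show ((y : ℕ) : ℤ) - (((x : ℕ) + i : ℕ) : ℤ) = (((y : ℕ) - x - i : ℕ) : ℤ) by omega]

theorem det_toeplitz_hInt (N : ℕ) :
    (Matrix.of fun x y : Fin N => hInt w z ((y : ℤ) - x)).det = 1 := by
  rw [Matrix.det_of_isUpperTriangular]
  · simp [hInt_zero]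
  · intro x y hxy
    have : (y : ℕ) < x := hxy
    exact hInt_of_neg z (by omega)

end Generating

section ComplementaryMinor

open Matrix

theorem replicateRow_mul_apply {R ι π κ : Type*} [CommRing R] [Fintype π]
    (A : Matrix ι π R) (s : ι) (M : Matrix π κ R) (j : κ) :
    (replicateRow (Fin 1) (A s) * M) 0 j = (A * M) s j := by
  simp [Matrix.mul_apply]

theorem replicateRow_single_sub_mul_apply {R ι κ : Type*} [CommRing R] [Fintype ι] [DecidableEq ι]
    (C : Matrix ι ι R) (r s : ι) (M : Matrix ι κ R) (j : κ) :
    (replicateRow (Fin 1) (Pi.single r 1 - C s : ι → R) * M) 0 j = M r j - (C * M) s j := by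
  simp [Matrix.mul_apply, sub_mul, Finset.sum_sub_distrib, Pi.single_apply]

variable {R ι π : Type*} [CommRing R] [Fintype ι] [Fintype π] [DecidableEq ι] [DecidableEq π]

/-- Cofactors of the upper right block `C` of a matrix are bordered minors of its inverse. -/
theorem det_mul_adjugate_eq_det_bordered
    (A : Matrix ι π R) (C : Matrix ι ι R) (B : Matrix π π R) (D : Matrix π ι R)
    (P : Matrix π ι R) (Q : Matrix π π R) (S : Matrix ι ι R) (T : Matrix ι π R)
    (hUV : fromBlocks A C B D * fromBlocks P Q S T = 1)
    (hVU : fromBlocks P Q S T * fromBlocks A C B D = 1) (r s : ι) :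
    (fromBlocks Q P T S).det * C.adjugate r s =
      (fromBlocks Q (replicateCol (Fin 1) fun i => P i s) (replicateRow (Fin 1) (T r))
        (of fun _ _ => S r s)).det := by
  rw [fromBlocks_multiply, ← fromBlocks_one, fromBlocks_inj] at hUV hVU
  obtain ⟨h1, h2, -, -⟩ := hUV
  obtain ⟨-, h3, -, h4⟩ := hVU
  set u : Matrix (Fin 1) ι R := replicateRow (Fin 1) (Pi.single r 1 - C s) with hu
  set Ps : Matrix π (Fin 1) R := replicateCol (Fin 1) fun i => P i s
  set Ss : Matrix ι (Fin 1) R := replicateCol (Fin 1) fun i => S i s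
  set C' := C.updateRow s (Pi.single r 1) with hC'
  have hPC : P * C' = P * C + Ps * u := by
    ext i j
    simp only [Matrix.mul_apply, Matrix.add_apply, Ps, u, replicateCol_apply, replicateRow_apply,
      Finset.univ_unique, Finset.sum_singleton, Pi.sub_apply]
    rw [← Finset.add_sum_erase _ _ (Finset.mem_univ s),
      ← Finset.add_sum_erase _ (fun k => P i k * C k j) (Finset.mem_univ s), hC', updateRow_self,
      Finset.sum_congr rfl fun k hk => by rw [updateRow_ne (Finset.ne_of_mem_erase hk)]]
    ring
  have hSC : S * C' = S * C + Ss * u := by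
    ext i j
    simp only [Matrix.mul_apply, Matrix.add_apply, Ss, u, replicateCol_apply, replicateRow_apply,
      Finset.univ_unique, Finset.sum_singleton, Pi.sub_apply]
    rw [← Finset.add_sum_erase _ _ (Finset.mem_univ s),
      ← Finset.add_sum_erase _ (fun k => S i k * C k j) (Finset.mem_univ s), hC', updateRow_self,
      Finset.sum_congr rfl fun k hk => by rw [updateRow_ne (Finset.ne_of_mem_erase hk)]]
    ring
  have hprod : fromBlocks Q P T S * fromBlocks 1 D 0 C' =
      fromBlocks Q (Ps * u) T (1 + Ss * u) := by
    rw [fromBlocks_multiply]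
    congr 1
    · simp
    · rw [hPC, ← add_assoc, add_comm (Q * D), h3, zero_add]
    · simp
    · rw [hSC, ← add_assoc, add_comm (T * D), h4]
  have hdet : (fromBlocks Q P T S).det * C'.det = (fromBlocks Q (Ps * u) T (1 + Ss * u)).det := by
    rw [← hprod, det_mul, det_fromBlocks_zero₂₁, det_one, one_mul]
  set a : Matrix (Fin 1) π R := replicateRow (Fin 1) (A s) with ha
  have huT : u * T = replicateRow (Fin 1) (T r) + a * Q := by
    ext i j
    rw [Subsingleton.elim i 0, hu, replicateRow_single_sub_mul_apply, Matrix.add_apply, ha,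
      replicateRow_mul_apply, eq_neg_of_add_eq_zero_right h2]
    simp
  have huS : 1 + u * Ss = (of fun _ _ => S r s) + a * Ps := by
    ext i j
    rw [Subsingleton.elim i 0, Subsingleton.elim j 0]
    have h1' := congrFun (congrFun h1 s) s
    rw [Matrix.add_apply, one_apply_eq] at h1'
    rw [Matrix.add_apply, Matrix.add_apply, hu, replicateRow_single_sub_mul_apply, ha,
      replicateRow_mul_apply]
    have e1 : (C * Ss) s 0 = (C * S) s s := rfl
    have e2 : (A * Ps) s 0 = (A * P) s s := rfl
    have e3 : Ss r 0 = S r s := rfl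
    rw [e1, e2, e3, of_apply, one_apply_eq]
    linear_combination -h1'
  let W : Matrix ((π ⊕ ι) ⊕ (Fin 1)) ((π ⊕ ι) ⊕ (Fin 1)) R :=
    fromBlocks (fromBlocks Q 0 T 1) (fromRows Ps Ss) (fromCols 0 (-u)) 1
  let e : (π ⊕ (Fin 1)) ⊕ ι ≃ (π ⊕ ι) ⊕ (Fin 1) :=
    (Equiv.sumAssoc _ _ _).trans
      (((Equiv.refl _).sumCongr (Equiv.sumComm _ _)).trans (Equiv.sumAssoc _ _ _).symm)
  have hW : W.submatrix e e =
      fromBlocks (fromBlocks Q Ps 0 1) (fromRows 0 (-u)) (fromCols T Ss) 1 := by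
    ext ((i | i) | i) ((j | j) | j) <;> rfl
  have hW1 : W.det = (fromBlocks Q (Ps * u) T (1 + Ss * u)).det := by
    rw [det_fromBlocks_one₂₂, fromRows_mul_fromCols, sub_eq_add_neg, fromBlocks_neg,
      fromBlocks_add]
    simp
  have hW2 : W.det = (fromBlocks Q Ps (u * T) (1 + u * Ss)).det := by
    rw [← det_submatrix_equiv_self e, hW, det_fromBlocks_one₂₂, fromRows_mul_fromCols,
      sub_eq_add_neg, fromBlocks_neg, fromBlocks_add]
    simp
  have hfac : fromBlocks Q Ps (u * T) (1 + u * Ss) =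
      fromBlocks 1 0 a 1 * fromBlocks Q Ps (replicateRow (Fin 1) (T r)) (of fun _ _ => S r s) := by
    rw [fromBlocks_multiply, huT, huS]
    congr 1
    · simp
    · simp
    · rw [Matrix.one_mul, add_comm]
    · rw [Matrix.one_mul, add_comm]
  rw [adjugate_apply, hdet, ← hW1, hW2, hfac, det_mul, det_fromBlocks_zero₁₂, det_one, det_one,
    one_mul, one_mul]

end ComplementaryMinor

section ToeplitzMinor

open Matrix

theorem finRotate_pow_apply_val (M k : ℕ) (x : Fin (M + 1)) :
    (((finRotate (M + 1)) ^ k) x : ℕ) = (x + k) % (M + 1) := by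
  induction k with
  | zero => simp [Nat.mod_eq_of_lt x.2]
  | succ k ih =>
    rw [pow_succ', Equiv.Perm.mul_apply, finRotate_apply, Fin.val_add, ih]
    simp [← add_assoc]

/-- The permutation of `Fin (p + n)` exchanging the two consecutive blocks. -/
def blockSwap (p n : ℕ) : Equiv.Perm (Fin (p + n)) :=
  finAddFlip.trans (finCongr (add_comm n p))

theorem sign_blockSwap (p n : ℕ) : Equiv.Perm.sign (blockSwap p n) = (-1) ^ (n * p) := by
  rcases Nat.eq_zero_or_pos (p + n) with h | h
  · obtain ⟨rfl, rfl⟩ : p = 0 ∧ n = 0 := by omega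
    rw [show blockSwap 0 0 = 1 from Equiv.ext fun i => i.elim0]
    simp
  obtain ⟨M, hM⟩ : ∃ M, p + n = M + 1 := ⟨p + n - 1, by omega⟩
  have key : blockSwap p n = finRotate (p + n) ^ n := by
    ext x
    have hx : ((finRotate (p + n) ^ n) x : ℕ) = (x + n) % (p + n) := by
      revert x
      rw [hM]
      exact finRotate_pow_apply_val M n
    rw [hx]
    refine Fin.addCases (fun i => ?_) (fun i => ?_) x
    · have := i.2
      simp only [blockSwap, Equiv.trans_apply, finAddFlip_apply_castAdd, finCongr_apply,
        Fin.val_cast, Fin.val_castAdd, Fin.val_natAdd]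
      rw [Nat.mod_eq_of_lt (by omega), add_comm]
    · simp only [blockSwap, Equiv.trans_apply, finAddFlip_apply_natAdd, finCongr_apply,
        Fin.val_cast, Fin.val_castAdd, Fin.val_natAdd]
      rw [show p + (i : ℕ) + n = i + (p + n) by ring, Nat.add_mod_right, Nat.mod_eq_of_lt]
      have := i.2
      omega
  rw [key, map_pow, sign_finRotate, ← pow_mul, neg_one_pow_congr]
  rcases p with _ | q
  · rw [zero_add, mul_zero]
    simpa [mul_comm] using Nat.even_mul_pred_self n
  · rw [show q + 1 + n - 1 = q + n by omega]
    simp only [Nat.even_mul, Nat.even_add, Nat.not_even_one]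
    tauto

variable {w : ℕ} (z : Fin w → ℂ)

/-- The cofactors of a Toeplitz matrix with symbol coefficients `(-1)^k e_k` are, up to sign,
determinants of complete homogeneous symmetric polynomials. -/
theorem adjugate_toeplitz_eInt (n p : ℕ) (r s : Fin n) :
    (of fun x y : Fin n => (-1 : ℂ) ^ ((p : ℤ) + y - x) * eInt w z ((p : ℤ) + y - x)).adjugate r s =
      (-1) ^ (p * (n - 1)) * (of fun j k : Fin (p + 1) =>
        hInt w z ((Fin.cons (s : ℤ) (fun i : Fin p => (n : ℤ) + i) : Fin (p + 1) → ℤ) j -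
          if (k : ℕ) = p then (p : ℤ) + r else k)).det := by
  set U : Matrix (Fin (p + n)) (Fin (p + n)) ℂ :=
    of fun x y => (-1 : ℂ) ^ ((y : ℤ) - x) * eInt w z ((y : ℤ) - x) with hU
  set V : Matrix (Fin (p + n)) (Fin (p + n)) ℂ := of fun x y => hInt w z ((y : ℤ) - x) with hV
  let g : Fin p ⊕ Fin n ≃ Fin (p + n) := finSumFinEquiv
  let f : Fin n ⊕ Fin p ≃ Fin (p + n) := finSumFinEquiv.trans (finCongr (add_comm n p))
  have hUV : U * V = 1 := toeplitz_eInt_mul_toeplitz_hInt z (p + n)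
  have hVU : V * U = 1 := mul_eq_one_comm.mp hUV
  have key := det_mul_adjugate_eq_det_bordered
    (U.submatrix f g).toBlocks₁₁ (U.submatrix f g).toBlocks₁₂
    (U.submatrix f g).toBlocks₂₁ (U.submatrix f g).toBlocks₂₂
    (V.submatrix g f).toBlocks₁₁ (V.submatrix g f).toBlocks₁₂
    (V.submatrix g f).toBlocks₂₁ (V.submatrix g f).toBlocks₂₂
    (by rw [fromBlocks_toBlocks, fromBlocks_toBlocks, submatrix_mul_equiv, hUV,
      submatrix_one_equiv])
    (by rw [fromBlocks_toBlocks, fromBlocks_toBlocks, submatrix_mul_equiv, hVU,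
      submatrix_one_equiv]) r s
  have hC : (U.submatrix f g).toBlocks₁₂ =
      of fun x y : Fin n => (-1 : ℂ) ^ ((p : ℤ) + y - x) * eInt w z ((p : ℤ) + y - x) := by
    ext x y
    simp [toBlocks₁₂, U, f, g]
  have hV' : fromBlocks (V.submatrix g f).toBlocks₁₂ (V.submatrix g f).toBlocks₁₁
      (V.submatrix g f).toBlocks₂₂ (V.submatrix g f).toBlocks₂₁ =
      (V.submatrix id (blockSwap p n)).submatrix g g := by
    ext (i | i) (j | j) <;> simp [toBlocks₁₂, toBlocks₁₁, toBlocks₂₂, toBlocks₂₁, blockSwap, f, g]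
  have hdet : (fromBlocks (V.submatrix g f).toBlocks₁₂ (V.submatrix g f).toBlocks₁₁
      (V.submatrix g f).toBlocks₂₂ (V.submatrix g f).toBlocks₂₁).det = (-1) ^ (n * p) := by
    rw [hV', det_submatrix_equiv_self, det_permute', sign_blockSwap, hV, det_toeplitz_hInt]
    simp
  set M : Matrix (Fin (p + 1)) (Fin (p + 1)) ℂ := of fun j k =>
    hInt w z ((Fin.cons (s : ℤ) (fun i : Fin p => (n : ℤ) + i) : Fin (p + 1) → ℤ) j -
      if (k : ℕ) = p then (p : ℤ) + r else k) with hM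
  have hB : fromBlocks (V.submatrix g f).toBlocks₁₂
      (replicateCol (Fin 1) fun i => (V.submatrix g f).toBlocks₁₁ i s)
      (replicateRow (Fin 1) ((V.submatrix g f).toBlocks₂₂ r))
      (of fun _ _ => (V.submatrix g f).toBlocks₂₁ r s) =
      (Mᵀ.submatrix id (finRotate (p + 1))).submatrix finSumFinEquiv finSumFinEquiv := by
    have hcast (j : Fin p) : finRotate (p + 1) (Fin.castAdd 1 j) = j.succ := by
      rw [finRotate_apply]
      exact Fin.coeSucc_eq_succ
    have hnat (j : Fin 1) : finRotate (p + 1) (Fin.natAdd p j) = 0 := by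
      rw [Subsingleton.elim j 0]
      exact finRotate_last
    ext (i | i) (j | j) <;>
      simp [toBlocks₁₂, toBlocks₁₁, toBlocks₂₂, toBlocks₂₁, V, M, f, g, hcast, hnat, i.2.ne,
        add_comm (n : ℤ)]
  rw [hdet, hC, hB, det_submatrix_equiv_self, det_permute', sign_finRotate, det_transpose] at key
  have hsq : (-1 : ℂ) ^ (n * p) * (-1) ^ (n * p) = 1 := by
    rw [← mul_pow]
    simp
  have hsgn : (-1 : ℂ) ^ (n * p) * (-1) ^ p = (-1) ^ (p * (n - 1)) := by
    obtain ⟨m, rfl⟩ : ∃ m, n = m + 1 := ⟨n - 1, by have := r.2; omega⟩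
    rw [Nat.add_sub_cancel, ← pow_add, show (m + 1) * p + p = p * m + 2 * p by ring, pow_add,
      pow_mul (-1 : ℂ) 2]
    simp
  rw [Nat.add_sub_cancel] at key
  push_cast at key
  rw [← hsgn]
  linear_combination (-1) ^ (n * p) * key - (of fun x y : Fin n =>
    (-1 : ℂ) ^ ((p : ℤ) + y - x) * eInt w z ((p : ℤ) + y - x)).adjugate r s * hsq

end ToeplitzMinor

section RowShift

open Matrix PowerSeries

theorem Matrix.det_update_sum_smul {m ι R : Type*} [CommRing R] [Fintype m] [DecidableEq m]
    (M : m → m → R) (i : m) (t : Finset ι) (c : ι → R) (v : ι → m → R) :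
    (of (Function.update M i (∑ a ∈ t, c a • v a))).det =
      ∑ a ∈ t, c a * (of (Function.update M i (v a))).det := by
  classical
  induction t using Finset.induction_on with
  | empty =>
    rw [Finset.sum_empty, Finset.sum_empty]
    exact det_eq_zero_of_row_eq_zero i fun j => by simp
  | insert a t ha ih =>
    rw [Finset.sum_insert ha, Finset.sum_insert ha, ← ih]
    exact (det_updateRow_add (of M) i _ _).trans
      (congrArg (· + _) (det_updateRow_smul (of M) i _ _))

variable {w : ℕ} (z : Fin w → ℂ)

/-- The row `(h_x, h_{x-1}, …, h_{x-p+1}, ∑_r h_{x-p-r} t^r)`. -/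
noncomputable def seriesRow (p : ℕ) (x : ℤ) (k : Fin (p + 1)) : PowerSeries ℂ :=
  if (k : ℕ) = p then PowerSeries.mk fun r => hInt w z (x - p - r) else C (hInt w z (x - k))

/-- The row `seriesRow z p x - t * seriesRow z p (x - 1)`. -/
noncomputable def diffRow (p : ℕ) (x : ℤ) : Fin (p + 1) → PowerSeries ℂ :=
  seriesRow z p x - (X : PowerSeries ℂ) • seriesRow z p (x - 1)

theorem coeff_det_seriesRow (p : ℕ) (κ : Fin (p + 1) → ℤ) (r : ℕ) :
    coeff r (of fun j => seriesRow z p (κ j)).det =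
      (of fun j k : Fin (p + 1) => hInt w z (κ j - if (k : ℕ) = p then (p : ℤ) + r else k)).det := by
  rw [det_succ_column _ (Fin.last p), det_succ_column _ (Fin.last p), map_sum]
  refine Finset.sum_congr rfl fun i _ => ?_
  have hsub : ((of fun j => seriesRow z p (κ j)).submatrix i.succAbove (Fin.last p).succAbove) =
      (C (R := ℂ)).mapMatrix ((of fun j k : Fin (p + 1) =>
        hInt w z (κ j - if (k : ℕ) = p then (p : ℤ) + r else k)).submatrix
          i.succAbove (Fin.last p).succAbove) := by
    ext1 j k
    simp [seriesRow, k.2.ne]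
  have hsign : ((-1 : PowerSeries ℂ) ^ ((i : ℕ) + (Fin.last p : ℕ))) =
      C ((-1) ^ ((i : ℕ) + (Fin.last p : ℕ))) := by simp
  rw [hsub, ← RingHom.map_det, coeff_mul_C, hsign, coeff_C_mul]
  simp [seriesRow, sub_sub]

theorem diffRow_last (p : ℕ) (x : ℤ) :
    diffRow z p x (Fin.last p) = C (hInt w z (x - p)) := by
  ext m
  cases m with
  | zero => simp [diffRow, seriesRow]
  | succ m =>
    simp [diffRow, seriesRow, coeff_succ_X_mul]
    ring_nf

theorem det_diffRow (p : ℕ) (κ : Fin (p + 1) → ℤ) :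
    (of fun j => diffRow z p (κ j)).det =
      C (of fun j k : Fin (p + 1) => hInt w z (κ j.rev - p + k)).det := by
  rw [← det_submatrix_equiv_self Fin.revPerm, RingHom.map_det]
  symm
  refine det_eq_of_forall_col_eq_smul_add_pred (fun _ => X) (fun i => ?_) fun i j => ?_
  · simp [diffRow_last]
  · have h1 : ((j.succ.rev : Fin (p + 1)) : ℕ) ≠ p := by
      have := j.2
      simp [Fin.val_rev]; omega
    have h2 : ((j.succ.rev : Fin (p + 1)) : ℤ) = p - j - 1 := by
      have := j.2
      simp only [Fin.val_rev, Fin.val_succ]; omega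
    simp only [submatrix_apply, of_apply, Fin.revPerm_apply, RingHom.mapMatrix_apply, map_apply,
      diffRow, Pi.sub_apply, Pi.smul_apply, smul_eq_mul, seriesRow, if_neg h1, h2, Fin.val_succ,
      Fin.val_castSucc]
    push_cast
    ring_nf

theorem seriesRow_eq_sum_diffRow (p : ℕ) (x : ℤ) (m : ℕ) :
    seriesRow z p x = ∑ a ∈ Finset.range m, (X : PowerSeries ℂ) ^ a • diffRow z p (x - a) +
      (X : PowerSeries ℂ) ^ m • seriesRow z p (x - m) := by
  induction m with
  | zero => simp
  | succ m ih =>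
    rw [ih, Finset.sum_range_succ, add_assoc]
    congr 1
    rw [diffRow, smul_sub, smul_smul, ← pow_succ, Nat.cast_succ, sub_sub, sub_add_cancel]

theorem seriesRow_neg_one (p : ℕ) : seriesRow z p (-1) = 0 := by
  ext k m
  rw [seriesRow]
  split_ifs
  · rw [coeff_mk, hInt_of_neg z (by omega)]
    simp
  · rw [hInt_of_neg z (by omega)]
    simp

theorem det_seriesRow (q n s : ℕ) (hs : s ≤ n) :
    (of fun j => seriesRow z (q + 1)
      ((Fin.cons (s : ℤ) (fun i : Fin (q + 1) => (n : ℤ) + i) : Fin (q + 2) → ℤ) j)).det =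
    ∑ b ∈ Finset.range (s + 1), ∑ a ∈ Finset.range (n - s), X ^ (a + b) *
      (of fun j => diffRow z (q + 1) ((Fin.cons ((s : ℤ) - b) (Fin.cons ((n : ℤ) - a)
        (fun i : Fin q => (n : ℤ) + 1 + i)) : Fin (q + 2) → ℤ) j)).det := by
  set u : Fin (q + 2) → PowerSeries ℂ :=
    ∑ b ∈ Finset.range (s + 1), (X : PowerSeries ℂ) ^ b • diffRow z (q + 1) ((s : ℤ) - b) with hu
  set v : Fin (q + 2) → PowerSeries ℂ :=
    ∑ a ∈ Finset.range (n - s), (X : PowerSeries ℂ) ^ a • diffRow z (q + 1) ((n : ℤ) - a) with hv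
  set L : Fin q → Fin (q + 2) → PowerSeries ℂ := fun i => diffRow z (q + 1) ((n : ℤ) + 1 + i)
  have hrow : (of fun j => seriesRow z (q + 1)
      ((Fin.cons (s : ℤ) (fun i : Fin (q + 1) => (n : ℤ) + i) : Fin (q + 2) → ℤ) j)).det =
      (of (Fin.cons u (Fin.cons v L) : Fin (q + 2) → Fin (q + 2) → PowerSeries ℂ)).det := by
    refine det_eq_of_forall_row_eq_smul_add_pred
      (Fin.cons (X ^ (n - s)) fun _ => X) (fun j => ?_) fun i j => ?_
    · have h := seriesRow_eq_sum_diffRow z (q + 1) s (s + 1)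
      rw [show ((s : ℤ) - (s + 1 : ℕ)) = -1 by push_cast; ring, seriesRow_neg_one, smul_zero,
        add_zero] at h
      exact congrFun h j
    · refine Fin.cases ?_ (fun i => ?_) i
      · have h := seriesRow_eq_sum_diffRow z (q + 1) n (n - s)
        rw [show ((n : ℤ) - (n - s : ℕ)) = s by omega] at h
        simpa [hv] using congrFun h j
      · have h := seriesRow_eq_sum_diffRow z (q + 1) ((n : ℤ) + 1 + i) 1
        rw [show ((n : ℤ) + 1 + i - (1 : ℕ)) = n + i by push_cast; ring] at h
        have h' := congrFun h j
        simp only [Finset.sum_range_one, pow_zero, one_smul, pow_one, Nat.cast_zero, sub_zero] at h'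
        simpa [Fin.castSucc_succ, L, add_assoc, add_comm (1 : ℤ)] using h'
  have h0 (x y : Fin (q + 2) → PowerSeries ℂ) :
      (Fin.cons x (Fin.cons y L) : Fin (q + 2) → Fin (q + 2) → PowerSeries ℂ) =
        Function.update (Fin.cons 0 (Fin.cons y L)) 0 x := by
    rw [Fin.update_cons_zero]
  have h1 (x y : Fin (q + 2) → PowerSeries ℂ) :
      (Fin.cons x (Fin.cons y L) : Fin (q + 2) → Fin (q + 2) → PowerSeries ℂ) =
        Function.update (Fin.cons x (Fin.cons 0 L)) 1 y := by
    rw [← Fin.succ_zero_eq_one, ← Fin.cons_update, Fin.update_cons_zero]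
  rw [hrow, h0, hu, det_update_sum_smul]
  refine Finset.sum_congr rfl fun b _ => ?_
  rw [← h0, h1, hv, det_update_sum_smul, Finset.mul_sum]
  refine Finset.sum_congr rfl fun a _ => ?_
  rw [← h1, ← mul_assoc, ← pow_add, add_comm b a]
  congr 2
  ext1 j
  exact Fin.cases (fun _ => rfl) (Fin.cases (fun _ => rfl) fun i _ => rfl) j

end RowShift

section SchurSum

open Matrix PowerSeries

variable {w : ℕ} (z : Fin w → ℂ)

theorem schur_eq_det_hInt (q : ℕ) (n s r k : ℤ) :
    schur w z (q + 2) (fun j => if j ≤ q then n - 1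
      else if j = q + 1 then n + s - r - 1 - k else k) =
    (of fun i j : Fin (q + 2) => hInt w z ((Fin.cons k (Fin.cons (n + s - r - k)
      (fun i : Fin q => n + 1 + i)) : Fin (q + 2) → ℤ) i.rev - (q + 1 : ℕ) + j)).det := by
  rw [schur, skewSchur]
  congr 1
  ext i j
  obtain ⟨i, rfl⟩ := Fin.rev_surjective i
  rw [of_apply, of_apply, Fin.rev_rev]
  congr 1
  refine Fin.cases ?_ (Fin.cases ?_ fun i => ?_) i
  · simp
    ring
  · simp [Fin.val_rev]
    ring
  · have := i.2
    have h : (i.succ.succ.rev : ℕ) + 1 ≤ q := by simp [Fin.val_rev]; omega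
    have h' : ((i.succ.succ.rev : ℕ) : ℤ) = q - 1 - i := by simp [Fin.val_rev]; omega
    rw [if_pos h, h']
    simp
    ring

/-- Expansion of the bordered determinant into Schur polynomials, with zero-based `r` and `s`. -/
theorem det_bordered_eq_sum_schur (q n r s : ℕ) (hsn : s ≤ n) :
    (of fun j k : Fin (q + 2) =>
      hInt w z ((Fin.cons (s : ℤ) (fun i : Fin (q + 1) => (n : ℤ) + i) : Fin (q + 2) → ℤ) j -
        if (k : ℕ) = q + 1 then ((q + 1 : ℕ) : ℤ) + r else k)).det =
    ∑ k ∈ Finset.Icc (max 0 ((s : ℤ) - r)) (min ((n : ℤ) - 1 - r) s),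
      schur w z (q + 2) (fun j => if j ≤ q then (n : ℤ) - 1
        else if j = q + 1 then (n : ℤ) + s - r - 1 - k else k) := by
  rw [← coeff_det_seriesRow z (q + 1), det_seriesRow z q n s hsn, map_sum]
  simp only [map_sum, det_diffRow, coeff_mul_C, coeff_X_pow, ite_mul, one_mul, zero_mul,
    schur_eq_det_hInt]
  rw [← Finset.sum_product', ← Finset.sum_filter]
  refine Finset.sum_bij' (fun ba _ => (s : ℤ) - ba.1)
    (fun k _ => (((s : ℤ) - k).toNat, (r - s + k).toNat)) ?_ ?_ ?_ ?_ ?_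
  · rintro ⟨b, a⟩ h
    simp only [Finset.mem_filter, Finset.mem_product, Finset.mem_range] at h
    simp only [Finset.mem_Icc]
    omega
  · intro k h
    simp only [Finset.mem_Icc] at h
    simp only [Finset.mem_filter, Finset.mem_product, Finset.mem_range]
    omega
  · rintro ⟨b, a⟩ h
    simp only [Finset.mem_filter, Finset.mem_product, Finset.mem_range] at h
    ext <;> simp only <;> omega
  · intro k h
    simp only [Finset.mem_Icc] at h
    simp only
    omega
  · rintro ⟨b, a⟩ h
    simp only [Finset.mem_filter, Finset.mem_product, Finset.mem_range] at h
    simp only [show (n : ℤ) + s - r - (s - b) = n - a by omega]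

end SchurSum

/-- Theorem 2, formula (eq:adj_through_Schur): for `p ≥ 1`,
`adj(T_n(a))_{r,s} = (-1)^{p(n-1)} a_p^{n-1}
  Σ_{k = max(0,s-r)}^{min(n-r,s-1)} s_{((n-1)^{p-1}, n+s-r-1-k, k)}`. -/
theorem toeplitz_adjugate_eq_sum_schur
    (w : ℕ) (hw : 1 ≤ w) (z : Fin w → ℂ) (p : ℕ) (hp : 1 ≤ p) (ap : ℂ) (hap : ap ≠ 0)
    (n : ℕ) (hn : 1 ≤ n) (r s : ℕ) (hr : 1 ≤ r) (hrn : r ≤ n) (hs : 1 ≤ s) (hsn : s ≤ n) :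
    Matrix.adjugate (toeplitz n (aCoeff w p ap z)) ⟨r - 1, by omega⟩ ⟨s - 1, by omega⟩
      = (-1 : ℂ) ^ (p * (n - 1)) * ap ^ (n - 1)
        * ∑ k ∈ Finset.Icc (max 0 ((s : ℤ) - (r : ℤ))) (min ((n : ℤ) - (r : ℤ)) ((s : ℤ) - 1)),
            schur w z (p + 1)
              (fun j => if j ≤ p - 1 then (n : ℤ) - 1
                else if j = p then (n : ℤ) + (s : ℤ) - (r : ℤ) - 1 - k else k) := by
  obtain ⟨q, rfl⟩ : ∃ q, p = q + 1 := ⟨p - 1, by omega⟩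
  obtain ⟨r, rfl⟩ : ∃ r', r = r' + 1 := ⟨r - 1, by omega⟩
  obtain ⟨s, rfl⟩ : ∃ s', s = s' + 1 := ⟨s - 1, by omega⟩
  have hT : toeplitz n (aCoeff w (q + 1) ap z) = ap • Matrix.of fun x y : Fin n =>
      (-1 : ℂ) ^ (((q + 1 : ℕ) : ℤ) + y - x) * eInt w z (((q + 1 : ℕ) : ℤ) + y - x) := by
    ext x y
    simp only [toeplitz, aCoeff, Matrix.of_apply, Matrix.smul_apply, smul_eq_mul, sub_sub_eq_add_sub]
    ring
  rw [hT, Matrix.adjugate_smul, Matrix.smul_apply, adjugate_toeplitz_eInt, smul_eq_mul,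
    Fintype.card_fin]
  simp only [Nat.add_sub_cancel]
  rw [det_bordered_eq_sum_schur z q n r s (by omega)]
  have hmax : max 0 (((s + 1 : ℕ) : ℤ) - (r + 1 : ℕ)) = max 0 ((s : ℤ) - r) := by
    push_cast; ring_nf
  have hmin : min ((n : ℤ) - (r + 1 : ℕ)) (((s + 1 : ℕ) : ℤ) - 1) = min ((n : ℤ) - 1 - r) s := by
    push_cast; ring_nf
  have hadd : (n : ℤ) + (s + 1 : ℕ) - (r + 1 : ℕ) = n + s - r := by push_cast; ring
  rw [hmax, hmin, hadd]
  ring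
end
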